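/- arXiv:2507.04863 — 2 statements merged into one kernel-verified Lean document; each statement's English description precedes it below -/
import Mathlib

section
/- Let $E$ be a field and $X$ transcendental over $E$. Then the map from intermediate fields of $E_{\mathrm{sep}}/E$ to intermediate fields of $E_{\mathrm{sep}}(X)/E(X)$ given by $E' \mapsto E'(X)$ is an inclusion-preserving bijection that preserves degrees of finite subextensions: $[E''(X) : E'(X)] = [E'' : E']$ for $E \subseteq E' \subseteq E'' \subseteq E_{\mathrm{sep}}$ with $[E'' : E']$ finite. -/
open IntermediateField

/-- The canonical ring homomorphism `RatFunc E →+* RatFunc Ω` induced by a field embedding. -/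
noncomputable def ratFuncMap (E Ω : Type) [Field E] [Field Ω] [Algebra E Ω] :
    RatFunc E →+* RatFunc Ω :=
  RatFunc.mapRingHom (Polynomial.mapRingHom (algebraMap E Ω)) (by
    intro x hx
    have hx0 : x ≠ 0 := mem_nonZeroDivisors_iff_ne_zero.mp hx
    refine Submonoid.mem_comap.mpr (mem_nonZeroDivisors_iff_ne_zero.mpr ?_)
    simpa using (Polynomial.map_ne_zero_iff (f := algebraMap E Ω)
      (algebraMap E Ω).injective).mpr hx0)

section helpers

variable (E Ω : Type) [Field E] [Field Ω] [Algebra E Ω]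

/-- The algebra structure used in the statement. -/
noncomputable abbrev ratAlg : Algebra (RatFunc E) (RatFunc Ω) := (ratFuncMap E Ω).toAlgebra

theorem ratFuncMap_div (p q : Polynomial E) :
    ratFuncMap E Ω (algebraMap _ _ p / algebraMap _ _ q) =
      algebraMap _ _ (p.map (algebraMap E Ω)) / algebraMap _ _ (q.map (algebraMap E Ω)) := by
  unfold ratFuncMap
  rw [RatFunc.coe_mapRingHom_eq_coe_map, RatFunc.map_apply_div]
  rfl

theorem ratFuncMap_algebraMap (p : Polynomial E) :
    ratFuncMap E Ω (algebraMap _ _ p) = algebraMap _ _ (p.map (algebraMap E Ω)) := by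
  simpa using ratFuncMap_div E Ω p 1

theorem ratFuncMap_X : ratFuncMap E Ω RatFunc.X = RatFunc.X := by
  rw [← RatFunc.algebraMap_X, ratFuncMap_algebraMap]; simp

theorem ratFuncMap_C (a : E) : ratFuncMap E Ω (RatFunc.C a) = RatFunc.C (algebraMap E Ω a) := by
  rw [← RatFunc.algebraMap_C, ratFuncMap_algebraMap]; simp

theorem finrank_ratAlg (k K : Type) [Field k] [Field K] [Algebra k K] [Algebra.IsAlgebraic k K] :
    @Module.finrank (RatFunc k) (RatFunc K) _ _ (ratAlg k K).toModule = Module.finrank k K := by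
  let : Algebra (Polynomial k) (Polynomial K) := Polynomial.algebra k K
  rw [← RatFunc.finrank_ratFunc_ratFunc k K]
  congr 2
  apply Algebra.algebra_ext
  intro r
  change ratFuncMap k K r = IsFractionRing.lift _ r
  refine congrFun (congrArg DFunLike.coe (IsLocalization.ringHom_ext (nonZeroDivisors (Polynomial k))
    (j := ratFuncMap k K) (k := IsFractionRing.lift (K := RatFunc k) (L := RatFunc K) (FaithfulSMul.algebraMap_injective (Polynomial k) (RatFunc K))) ?_)) r
  refine RingHom.ext fun p => ?_
  simp only [RingHom.comp_apply, IsFractionRing.lift_algebraMap, ratFuncMap_algebraMap]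
  rfl

attribute [local instance] ratAlg

theorem alg_eq (x : RatFunc E) : algebraMap (RatFunc E) (RatFunc Ω) x = ratFuncMap E Ω x := rfl

instance ratTower : IsScalarTower E (RatFunc E) (RatFunc Ω) := by
  refine IsScalarTower.of_algebraMap_eq fun a => ?_
  rw [alg_eq, RatFunc.algebraMap_eq_C, ratFuncMap_C]
  rfl

variable {E Ω}

theorem X_mem (K : IntermediateField (RatFunc E) (RatFunc Ω)) : (RatFunc.X : RatFunc Ω) ∈ K := by
  rw [← ratFuncMap_X E Ω]; exact K.algebraMap_mem _

theorem poly_mem (K : IntermediateField (RatFunc E) (RatFunc Ω)) (p : Polynomial Ω)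
    (h : ∀ n, RatFunc.C (p.coeff n) ∈ K) : algebraMap _ (RatFunc Ω) p ∈ K := by
  rw [p.as_sum_range_C_mul_X_pow, map_sum]
  refine sum_mem fun n _ => ?_
  rw [map_mul, map_pow, RatFunc.algebraMap_C, RatFunc.algebraMap_X]
  exact mul_mem (h n) (pow_mem (X_mem K) n)

theorem ratFunc_mem (K : IntermediateField (RatFunc E) (RatFunc Ω)) (x : RatFunc Ω)
    (h : ∀ n, RatFunc.C (x.num.coeff n) ∈ K) (hden : ∀ n, RatFunc.C (x.denom.coeff n) ∈ K) :
    x ∈ K := by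
  rw [← RatFunc.num_div_denom x]
  exact div_mem (poly_mem K _ h) (poly_mem K _ hden)

/-- The map of the statement. -/
noncomputable abbrev fMap (E' : IntermediateField E Ω) :
    IntermediateField (RatFunc E) (RatFunc Ω) :=
  IntermediateField.adjoin (RatFunc E) (RatFunc.C '' (E' : Set Ω))

theorem C_mem_fMap (E' : IntermediateField E Ω) {a : Ω} (h : a ∈ E') :
    RatFunc.C a ∈ fMap E' := subset_adjoin _ _ ⟨a, h, rfl⟩

theorem mem_fMap_iff (E' : IntermediateField E Ω) (x : RatFunc Ω) :
    x ∈ fMap E' ↔ ∃ y, ratFuncMap E' Ω y = x := by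
  constructor
  · intro hx
    let R : IntermediateField (RatFunc E) (RatFunc Ω) :=
      (ratFuncMap E' Ω).fieldRange.toIntermediateField (by
        intro z
        refine ⟨ratFuncMap E E' z, ?_⟩
        rw [alg_eq, ← RatFunc.num_div_denom z, ratFuncMap_div, ratFuncMap_div, ratFuncMap_div,
          Polynomial.map_map, Polynomial.map_map, ← IsScalarTower.algebraMap_eq])
    have : fMap E' ≤ R := by
      rw [adjoin_le_iff]
      rintro _ ⟨a, ha, rfl⟩
      exact ⟨RatFunc.C ⟨a, ha⟩, ratFuncMap_C _ _ _⟩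
    exact this hx
  · rintro ⟨y, rfl⟩
    rw [← RatFunc.num_div_denom y, ratFuncMap_div]
    refine div_mem (poly_mem _ _ fun n => ?_) (poly_mem _ _ fun n => ?_) <;>
    · rw [Polynomial.coeff_map]
      exact C_mem_fMap _ (Subtype.property _)

theorem C_mem_fMap_iff (E' : IntermediateField E Ω) (a : Ω) :
    RatFunc.C a ∈ fMap E' ↔ a ∈ E' := by
  refine ⟨fun h => ?_, C_mem_fMap E'⟩
  obtain ⟨y, hy⟩ := (mem_fMap_iff _ _).1 h
  rw [← RatFunc.num_div_denom y, ratFuncMap_div, div_eq_iff, ← RatFunc.algebraMap_C, ← map_mul] at hy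
  · have := congrArg (fun p => Polynomial.coeff p y.denom.natDegree)
      (RatFunc.algebraMap_injective Ω hy)
    simp only [Polynomial.coeff_map, Polynomial.coeff_C_mul, Polynomial.coeff_natDegree,
      (RatFunc.monic_denom y).leadingCoeff, map_one, mul_one] at this
    rw [← this]
    exact Subtype.property _
  · simpa using (RatFunc.denom_ne_zero y)

theorem fMap_le_iff (E' E'' : IntermediateField E Ω) : E' ≤ E'' ↔ fMap E' ≤ fMap E'' := by
  constructor
  · intro h
    exact adjoin.mono _ _ _ (Set.image_mono h)
  · intro h a ha
    exact (C_mem_fMap_iff _ _).1 (h (C_mem_fMap _ ha))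

/-- `E'(X)` is the field of rational functions over `E'`. -/
noncomputable def fEquiv (E' : IntermediateField E Ω) : RatFunc E' ≃+* fMap E' :=
  RingEquiv.ofBijective
    ((ratFuncMap E' Ω).codRestrict (fMap E') fun y => (mem_fMap_iff _ _).2 ⟨y, rfl⟩)
    ⟨fun a b h => (ratFuncMap E' Ω).injective (congrArg Subtype.val h), fun ⟨x, hx⟩ => by
      obtain ⟨y, hy⟩ := (mem_fMap_iff _ _).1 hx
      exact ⟨y, Subtype.ext hy⟩⟩

theorem fEquiv_coe (E' : IntermediateField E Ω) (y : RatFunc E') :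
    (fEquiv E' y : RatFunc Ω) = ratFuncMap E' Ω y := rfl

theorem relfinrank_fMap [Algebra.IsAlgebraic E Ω] (E' E'' : IntermediateField E Ω) (h : E' ≤ E'') :
    relfinrank (fMap E') (fMap E'') = relfinrank E' E'' := by
  rw [relfinrank_eq_finrank_of_le h, relfinrank_eq_finrank_of_le ((fMap_le_iff _ _).1 h)]
  have : Algebra.IsAlgebraic E' (extendScalars h) := Algebra.IsAlgebraic.tower_bot E' _ Ω
  rw [← finrank_ratAlg E' (extendScalars h)]
  symm
  refine Algebra.finrank_eq_of_equiv_equiv (fEquiv E') (S₀ := RatFunc (extendScalars h))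
    (S₁ := extendScalars ((fMap_le_iff _ _).1 h)) (fEquiv E'') ?_
  ext1 z
  apply Subtype.ext
  change ratFuncMap E' Ω z = ratFuncMap E'' Ω (ratFuncMap E' (extendScalars h) z)
  change ratFuncMap E' Ω z = ratFuncMap (extendScalars h) Ω (ratFuncMap E' (extendScalars h) z)
  rw [← RatFunc.num_div_denom z, ratFuncMap_div, ratFuncMap_div, ratFuncMap_div,
          Polynomial.map_map, Polynomial.map_map, ← IsScalarTower.algebraMap_eq]

theorem adjoin_C_top :
    IntermediateField.adjoin (RatFunc E) (Set.range (RatFunc.C : Ω → RatFunc Ω)) = ⊤ := by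
  rw [eq_top_iff]
  intro x _
  exact ratFunc_mem _ x (fun n => subset_adjoin _ _ ⟨_, rfl⟩) (fun n => subset_adjoin _ _ ⟨_, rfl⟩)

theorem ratFunc_isGalois [IsGalois E Ω] : IsGalois (RatFunc E) (RatFunc Ω) := by
  have hsep : Algebra.IsSeparable (RatFunc E) (RatFunc Ω) := by
    rw [← separableClosure.eq_top_iff, eq_top_iff, ← adjoin_C_top, adjoin_le_iff]
    rintro _ ⟨a, rfl⟩
    change RatFunc.C a ∈ separableClosure _ _
    rw [mem_separableClosure_iff]
    have h1 : IsSeparable E (algebraMap Ω (RatFunc Ω) a) :=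
      (Algebra.IsSeparable.isSeparable E a).map (IsScalarTower.toAlgHom E Ω (RatFunc Ω))
        (algebraMap Ω (RatFunc Ω)).injective
    exact h1.tower_top (RatFunc E)
  have hnorm : Normal (RatFunc E) (RatFunc Ω) := by
    refine normal_iff.2 fun x => ⟨Algebra.IsIntegral.isIntegral x, ?_⟩
    have hx : x ∈ IntermediateField.adjoin (RatFunc E) (Set.range (RatFunc.C : Ω → RatFunc Ω)) := by
      rw [adjoin_C_top]; trivial
    refine splits_of_mem_adjoin (RatFunc E) (RatFunc Ω) (L := RatFunc Ω) ?_ hx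
    rintro _ ⟨a, rfl⟩
    refine ⟨Algebra.IsIntegral.isIntegral _, ?_⟩
    have h1 : ((minpoly E a).map (algebraMap E (RatFunc Ω))).Splits := by
      rw [IsScalarTower.algebraMap_eq E Ω (RatFunc Ω), ← Polynomial.map_map]
      exact (Normal.splits inferInstance a).map _
    rw [IsScalarTower.algebraMap_eq E (RatFunc E) (RatFunc Ω), ← Polynomial.map_map] at h1
    refine h1.of_dvd ?_ ?_
    · simpa using minpoly.ne_zero (Algebra.IsIntegral.isIntegral (R := E) a)
    · refine Polynomial.map_dvd _ (minpoly.dvd _ _ ?_)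
      rw [Polynomial.aeval_map_algebraMap]
      change Polynomial.aeval (algebraMap Ω (RatFunc Ω) a) _ = 0
      rw [Polynomial.aeval_algebraMap_apply, minpoly.aeval, map_zero]
  exact ⟨⟩

/-- An `E(X)`-automorphism of `Ω(X)` fixing `x` fixes the coefficients of its reduced form. -/
theorem coeff_fixed [IsGalois E Ω] (τ : RatFunc Ω ≃ₐ[RatFunc E] RatFunc Ω) (x : RatFunc Ω)
    (hx : τ x = x) (n : ℕ) : τ (RatFunc.C (x.num.coeff n)) = RatFunc.C (x.num.coeff n) ∧
      τ (RatFunc.C (x.denom.coeff n)) = RatFunc.C (x.denom.coeff n) := by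
  let σ : Ω ≃ₐ[E] Ω := (τ.restrictScalars E).restrictNormal Ω
  have hσ (a : Ω) : τ (RatFunc.C a) = RatFunc.C (σ a) :=
    ((τ.restrictScalars E).restrictNormal_commutes Ω a).symm
  have hX : τ RatFunc.X = RatFunc.X := by
    rw [← ratFuncMap_X E Ω]; exact τ.commutes _
  have hp (p : Polynomial Ω) : τ (algebraMap _ _ p) = algebraMap _ _ (p.map (σ : Ω →+* Ω)) := by
    induction p using Polynomial.induction_on' with
    | add p q hp hq => simp [hp, hq]
    | monomial n a =>
      rw [← Polynomial.C_mul_X_pow_eq_monomial]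
      simp [hσ, hX]
  have hd0 : algebraMap _ (RatFunc Ω) x.denom ≠ 0 := by
    simpa using RatFunc.denom_ne_zero x
  have hd1 : algebraMap _ (RatFunc Ω) (x.denom.map (σ : Ω →+* Ω)) ≠ 0 := by
    rw [← hp]; simpa using RatFunc.denom_ne_zero x
  have key : x.num.map (σ : Ω →+* Ω) * x.denom = x.num * x.denom.map (σ : Ω →+* Ω) := by
    apply RatFunc.algebraMap_injective Ω
    have h := hx
    rw [← RatFunc.num_div_denom x, map_div₀, hp, hp, div_eq_div_iff hd1 hd0] at h
    simpa only [map_mul] using h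
  have hdvd : x.denom ∣ x.denom.map (σ : Ω →+* Ω) :=
    (RatFunc.isCoprime_num_denom x).symm.dvd_of_dvd_mul_left (Dvd.intro_left _ key)
  have hden : x.denom.map (σ : Ω →+* Ω) = x.denom := by
    refine (Polynomial.eq_of_monic_of_dvd_of_natDegree_le (RatFunc.monic_denom x)
      ((RatFunc.monic_denom x).map _) hdvd ?_)
    rw [Polynomial.natDegree_map]
  have hnum : x.num.map (σ : Ω →+* Ω) = x.num := by
    rw [hden] at key
    exact mul_right_cancel₀ (RatFunc.denom_ne_zero x) key
  constructor
  · rw [hσ]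
    conv_rhs => rw [← hnum, Polynomial.coeff_map]
    rfl
  · rw [hσ]
    conv_rhs => rw [← hden, Polynomial.coeff_map]
    rfl

theorem fMap_surjective [IsGalois E Ω] :
    Function.Surjective (fMap : IntermediateField E Ω → _) := by
  intro K
  let E' : IntermediateField E Ω :=
    (K.restrictScalars E).comap (IsScalarTower.toAlgHom E Ω (RatFunc Ω))
  have hE' (a : Ω) : a ∈ E' ↔ RatFunc.C a ∈ K := Iff.rfl
  refine ⟨E', le_antisymm ?_ ?_⟩
  · rw [adjoin_le_iff]
    rintro _ ⟨a, ha, rfl⟩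
    exact ha
  · intro x hx
    have := ratFunc_isGalois (E := E) (Ω := Ω)
    have hfix (c : RatFunc Ω) (hc : ∀ τ : RatFunc Ω ≃ₐ[RatFunc E] RatFunc Ω, τ x = x → τ c = c) :
        c ∈ K := by
      rw [← InfiniteGalois.fixedField_fixingSubgroup K]
      rintro ⟨τ, hτ⟩
      exact hc τ (hτ ⟨x, hx⟩)
    refine ratFunc_mem _ x (fun n => C_mem_fMap _ ((hE' _).2 (hfix _ fun τ h => ?_)))
      (fun n => C_mem_fMap _ ((hE' _).2 (hfix _ fun τ h => ?_)))
    · exact (coeff_fixed τ x h n).1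
    · exact (coeff_fixed τ x h n).2

end helpers

/-- The map `E' ↦ E'(X)` is an inclusion-preserving bijection from intermediate
fields of `E_sep/E` to intermediate fields of `E_sep(X)/E(X)` preserving degrees of finite
subextensions. -/
theorem ratFunc_intermediateField_bijection (E Ω : Type) [Field E] [Field Ω] [Algebra E Ω]
    [IsSepClosure E Ω] :
    letI : Algebra (RatFunc E) (RatFunc Ω) := (ratFuncMap E Ω).toAlgebra
    let f : IntermediateField E Ω → IntermediateField (RatFunc E) (RatFunc Ω) :=
      fun E' => IntermediateField.adjoin (RatFunc E) (RatFunc.C '' (E' : Set Ω))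
    Function.Bijective f ∧
      (∀ E' E'' : IntermediateField E Ω, E' ≤ E'' ↔ f E' ≤ f E'') ∧
      ∀ E' E'' : IntermediateField E Ω, E' ≤ E'' →
        relfinrank (f E') (f E'') = relfinrank E' E'' := by
  intro f
  refine ⟨⟨fun A B h => le_antisymm ((fMap_le_iff A B).2 h.le) ((fMap_le_iff B A).2 h.ge),
    fMap_surjective⟩, fMap_le_iff, ?_⟩
  have : Algebra.IsAlgebraic E Ω := inferInstance
  exact relfinrank_fMap
end

section
/- Let $E$ be a field of characteristic $q > 0$ with $[E : E^q] = q^\delta$ finite, $U$ a separable algebraic extension of $E$, and $W = U \cdot E((Z))$ the compositum inside $U((Z))$. Let $w$ be the restriction to $W$ of the standard $Z$-adic valuation on $U((Z))$. Then $w(W^\times) = \mathbb{Z}$, the valuation ring of $w$ is $O_w(W) = U \cdot E[[Z]]$, the residue field of $(W, w)$ is $U$, and $[W : W^q] = q^{1+\delta}$. -/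
set_option maxHeartbeats 1000000
set_option synthInstance.maxHeartbeats 400000

instance subfieldCharP (R : Type) [Field R] (p : ℕ) [CharP R p] (S : Subfield R) : CharP S p :=
  ⟨fun x => Iff.symm <| (CharP.cast_eq_zero_iff R p x).symm.trans
    ⟨fun h => Subtype.eq <| show S.subtype x = 0 by rw [map_natCast, h],
     fun h => map_natCast S.subtype x ▸ by rw [h, RingHom.map_zero]⟩⟩

instance laurentSeriesCharP (E : Type) [Field E] (q : ℕ) [CharP E q] :
    CharP (LaurentSeries E) q :=
  charP_of_injective_ringHom (f := (HahnSeries.C : E →+* LaurentSeries E))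
    HahnSeries.C_injective q

/-- The compositum `W = U ⬝ E((Z))` inside the Laurent series field `U((Z))`, for a field
extension `U/E`:  the subfield generated by (the image of) `U` and the Laurent series with
coefficients in `E`. -/
noncomputable def laurentCompositum (E U : Type) [Field E] [Field U] [Algebra E U] :
    Subfield (LaurentSeries U) :=
  Subfield.closure
    (Set.range (HahnSeries.C : U →+* LaurentSeries U) ∪
      {f : LaurentSeries U | ∀ i : ℤ, f.coeff i ∈ (algebraMap E U).range})

namespace LCV

/-- `b` is a `q`-basis (in the sense of a linear basis over the subfield of `q`-th powers). -/
def IsPB (q : ℕ) {ι K : Type} [Fintype ι] [Field K] (b : ι → K) : Prop :=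
  (∀ x : K, ∃ c : ι → K, x = ∑ i, c i ^ q * b i) ∧
  (∀ c : ι → K, ∑ i, c i ^ q * b i = 0 → ∀ i, c i = 0)

theorem finrank_of_isPB (q : ℕ) [Fact q.Prime] {ι K : Type} [Fintype ι] [Field K] [CharP K q]
    (b : ι → K) (hb : IsPB q b) :
    Module.finrank ((frobenius K q).fieldRange) K = Fintype.card ι := by
  have hli : LinearIndependent ((frobenius K q).fieldRange) b := by
    rw [Fintype.linearIndependent_iff]
    intro g hg i
    have : ∀ i, ∃ c : K, c ^ q = (g i : K) := fun i => by
      obtain ⟨c, hc⟩ := (g i).2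
      exact ⟨c, by simpa [frobenius_def] using hc⟩
    choose c hc using this
    have h0 := hb.2 c (by
      rw [← hg]
      refine Finset.sum_congr rfl fun i _ => ?_
      rw [hc]; rfl) i
    apply Subtype.ext
    rw [← hc i, h0]
    simp [(Fact.out : q.Prime).ne_zero]
  have hsp : ⊤ ≤ Submodule.span ((frobenius K q).fieldRange) (Set.range b) := by
    intro x _
    obtain ⟨c, hc⟩ := hb.1 x
    rw [hc]
    refine Submodule.sum_mem _ fun i _ => ?_
    have : c i ^ q * b i = (⟨c i ^ q, ⟨c i, by simp [frobenius_def]⟩⟩ :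
      (frobenius K q).fieldRange) • b i := rfl
    rw [this]
    exact Submodule.smul_mem _ _ (Submodule.subset_span ⟨i, rfl⟩)
  exact Module.finrank_eq_card_basis (Module.Basis.mk hli hsp)

theorem exists_isPB (q : ℕ) [Fact q.Prime] {K : Type} [Field K] [CharP K q] (n : ℕ) (hn : 0 < n)
    (h : Module.finrank ((frobenius K q).fieldRange) K = n) :
    ∃ b : Fin n → K, IsPB q b := by
  have : Module.Finite ((frobenius K q).fieldRange) K :=
    Module.finite_of_finrank_pos (by rw [h]; exact hn)
  let b := Module.finBasisOfFinrankEq _ _ h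
  refine ⟨b, fun x => ?_, fun c hc i => ?_⟩
  · have : ∀ i, ∃ c : K, c ^ q = ((b.repr x i : (frobenius K q).fieldRange) : K) := fun i => by
      obtain ⟨c, hc⟩ := (b.repr x i).2
      exact ⟨c, by simpa [frobenius_def] using hc⟩
    choose c hc using this
    refine ⟨c, ?_⟩
    conv_lhs => rw [← b.sum_repr x]
    refine Finset.sum_congr rfl fun i _ => ?_
    rw [hc]; rfl
  · have := Fintype.linearIndependent_iff.1 b.linearIndependent
      (fun i => ⟨c i ^ q, ⟨c i, by simp [frobenius_def]⟩⟩) hc i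
    exact pow_eq_zero_iff (Fact.out : q.Prime).ne_zero |>.1 (congrArg Subtype.val this)

section ext
variable (q : ℕ) [Fact q.Prime] {E U : Type} [Field E] [Field U]
    [Algebra E U] [CharP E q] [CharP U q] [Algebra.IsSeparable E U] {ι : Type} [Fintype ι]

theorem li_ext (b : ι → E) (hb : IsPB q b) (c : ι → U)
    (hc : ∑ i, c i ^ q * algebraMap E U (b i) = 0) (i : ι) : c i = 0 := by
  classical
  have : ExpChar E q := ExpChar.prime Fact.out
  have : ExpChar U q := ExpChar.prime Fact.out
  let B := Module.Basis.ofVectorSpace E U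
  have hB := B.linearIndependent.map_pow_expChar_pow_of_isSeparable q 1
  simp only [pow_one] at hB
  let s : Finset _ := Finset.univ.biUnion fun j => (B.repr (c j)).support
  have hrep : ∀ j, c j = ∑ k ∈ s, B.repr (c j) k • B k := fun j => by
    conv_lhs => rw [← B.linearCombination_repr (c j)]
    rw [Finsupp.linearCombination_apply, Finsupp.sum_of_support_subset]
    · exact Finset.subset_biUnion_of_mem (fun j => (B.repr (c j)).support) (Finset.mem_univ j)
    · simp
  have hpow : ∀ j, c j ^ q = ∑ k ∈ s, (B.repr (c j) k) ^ q • B k ^ q := fun j => by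
    conv_lhs => rw [hrep j]
    rw [sum_pow_char]
    refine Finset.sum_congr rfl fun k _ => ?_
    rw [smul_pow]
  have h2 : ∑ k ∈ s, (∑ j, (B.repr (c j) k) ^ q * b j) • B k ^ q = 0 := by
    rw [← hc]
    simp_rw [hpow, Finset.sum_mul, Finset.sum_smul]
    rw [Finset.sum_comm]
    refine Finset.sum_congr rfl fun j _ => Finset.sum_congr rfl fun k _ => ?_
    simp only [Algebra.smul_def, map_mul]
    ring
  have h3 := linearIndependent_iff'.1 hB s _ h2
  rw [hrep i]
  refine Finset.sum_eq_zero fun k hk => ?_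
  rw [hb.2 _ (h3 k hk) i, zero_smul]

theorem span_ext (b : ι → E) (hb : IsPB q b) (F : IntermediateField E U) (x : U) (hx : x ∈ F) :
    ∃ c : ι → U, (∀ i, c i ∈ F) ∧ x = ∑ i, c i ^ q * algebraMap E U (b i) := by
  have : ExpChar E q := ExpChar.prime Fact.out
  have : ExpChar U q := ExpChar.prime Fact.out
  have h1 := IntermediateField.adjoin_simple_eq_adjoin_pow_expChar_of_isSeparable' E U x q
  have h2 : x ∈ IntermediateField.adjoin E {x ^ q} := by
    rw [← h1]; exact IntermediateField.mem_adjoin_simple_self E x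
  have hint : IsIntegral E (x ^ q) := (Algebra.IsSeparable.isIntegral E x).pow q
  rw [← IntermediateField.mem_toSubalgebra,
    IntermediateField.adjoin_simple_toSubalgebra_of_isAlgebraic hint.isAlgebraic,
    Algebra.adjoin_singleton_eq_range_aeval] at h2
  obtain ⟨P, hP⟩ := h2
  have hP' : Polynomial.aeval (x ^ q) P = x := hP
  rw [Polynomial.aeval_eq_sum_range] at hP'
  choose d hd using fun n => hb.1 (P.coeff n)
  refine ⟨fun i => ∑ n ∈ Finset.range (P.natDegree + 1), d n i • x ^ n, fun i => ?_, ?_⟩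
  · exact sum_mem fun n _ => F.smul_mem (pow_mem hx n)
  · conv_lhs => rw [← hP']
    simp_rw [sum_pow_char, Finset.sum_mul]
    rw [Finset.sum_comm]
    refine Finset.sum_congr rfl fun n _ => ?_
    rw [hd n, Finset.sum_smul]
    refine Finset.sum_congr rfl fun j _ => ?_
    simp only [Algebra.smul_def, map_mul, map_pow, mul_pow]
    ring

end ext

section coeffs

theorem ps_coeff_pow (q : ℕ) [Fact q.Prime] {U : Type} [Field U] [CharP U q] (P : PowerSeries U)
    (n : ℕ) : PowerSeries.coeff n (P ^ q) = if q ∣ n then (PowerSeries.coeff (n / q) P) ^ q else 0 := by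
  have : ExpChar U q := ExpChar.prime Fact.out
  have hq : q ≠ 0 := (Fact.out : q.Prime).ne_zero
  have h : PowerSeries.map (frobenius U q) (PowerSeries.expand q hq P) = P ^ q :=
    MvPowerSeries.map_frobenius_expand q hq
  rw [← h, PowerSeries.coeff_map, PowerSeries.coeff_expand]
  split_ifs <;> simp [frobenius_def, hq]

theorem coeff_pow (q : ℕ) [Fact q.Prime] {U : Type} [Field U] [CharP U q] (f : LaurentSeries U)
    (n : ℤ) : (f ^ q).coeff n = if (q : ℤ) ∣ n then (f.coeff (n / q)) ^ q else 0 := by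
  have hq : q ≠ 0 := (Fact.out : q.Prime).ne_zero
  have hq' : (q : ℤ) ≠ 0 := by exact_mod_cast hq
  have key : ∀ (N : ℤ) (P : PowerSeries U) (m : ℤ),
      (HahnSeries.single N (1 : U) * HahnSeries.ofPowerSeries ℤ U P).coeff m =
        if m - N < 0 then 0 else PowerSeries.coeff (m - N).natAbs P := by
    intro N P m
    rw [HahnSeries.coeff_single_mul, one_mul, PowerSeries.coeff_coe]
  obtain ⟨N, P, hf⟩ : ∃ (N : ℤ) (P : PowerSeries U),
      f = HahnSeries.single N (1 : U) * HahnSeries.ofPowerSeries ℤ U P :=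
    ⟨f.order, f.powerSeriesPart, (LaurentSeries.single_order_mul_powerSeriesPart f).symm⟩
  have hfq : f ^ q = HahnSeries.single (q * N) (1 : U) * HahnSeries.ofPowerSeries ℤ U (P ^ q) := by
    rw [hf, mul_pow, HahnSeries.single_pow, map_pow (HahnSeries.ofPowerSeries ℤ U)]
    rw [one_pow, nsmul_eq_mul]
  rw [hfq, hf, key, key, ps_coeff_pow]
  by_cases hd : (q : ℤ) ∣ n
  · obtain ⟨m, rfl⟩ := hd
    have hqpos : (0 : ℤ) < q := by positivity
    rw [if_pos (Dvd.intro _ rfl), Int.mul_ediv_cancel_left _ hq', ← mul_sub]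
    have : (q : ℤ) * (m - N) < 0 ↔ m - N < 0 := by
      constructor <;> intro h <;> nlinarith
    simp only [this]
    split_ifs with h1 h2 h2
    · simp [hq]
    · rw [Int.natAbs_mul, Int.natAbs_natCast, Nat.mul_div_cancel_left _ (Nat.pos_of_ne_zero hq)]
    · exact absurd (by rw [Int.natAbs_mul, Int.natAbs_natCast]; exact Dvd.intro _ rfl) h2
  · rw [if_neg hd]
    split_ifs with h1 h2
    · rfl
    · exfalso
      apply hd
      have h3 : (q : ℤ) ∣ n - q * N := Int.natCast_dvd.2 h2
      simpa using dvd_add h3 (Dvd.intro N rfl : (q : ℤ) ∣ q * N)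
    · rfl

end coeffs

section mem
variable {E U : Type} [Field E] [Field U] [Algebra E U]

theorem map_of_coeff (F : IntermediateField E U) (f : LaurentSeries U) (h : ∀ i, f.coeff i ∈ F) :
    ∃ g : LaurentSeries F, g.map F.val.toRingHom = f := by
  refine ⟨⟨fun i => ⟨f.coeff i, h i⟩, ?_⟩, ?_⟩
  · convert f.isPWO_support using 1
    ext i
    simp [Subtype.ext_iff]
  · ext i; rfl

theorem coeff_map_mem (F : IntermediateField E U) (g : LaurentSeries F) (i : ℤ) :
    (g.map F.val.toRingHom).coeff i ∈ F := (g.coeff i).2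

theorem mul_map (F : IntermediateField E U) (g h : LaurentSeries F) :
    (g * h).map F.val.toRingHom = g.map F.val.toRingHom * h.map F.val.toRingHom :=
  HahnSeries.map_mul (F.val.toRingHom : F →ₙ+* U)

theorem mul_coeff_mem (F : IntermediateField E U) (f g : LaurentSeries U)
    (hf : ∀ i, f.coeff i ∈ F) (hg : ∀ i, g.coeff i ∈ F) (i : ℤ) : (f * g).coeff i ∈ F := by
  obtain ⟨f, rfl⟩ := map_of_coeff F f hf
  obtain ⟨g, rfl⟩ := map_of_coeff F g hg
  rw [← mul_map]
  exact coeff_map_mem F _ i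

theorem inv_coeff_mem (F : IntermediateField E U) (f : LaurentSeries U)
    (hf : ∀ i, f.coeff i ∈ F) (i : ℤ) : (f⁻¹).coeff i ∈ F := by
  by_cases h0 : f = 0
  · subst h0; simp
  obtain ⟨g, rfl⟩ := map_of_coeff F f hf
  have hg : g ≠ 0 := by
    rintro rfl
    apply h0
    ext i; simp
  have h1 : g.map F.val.toRingHom * (g⁻¹).map F.val.toRingHom = 1 := by
    rw [← mul_map, mul_inv_cancel₀ hg]
    exact HahnSeries.map_one (F.val.toRingHom.toMonoidWithZeroHom)
  rw [inv_eq_of_mul_eq_one_right h1]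
  exact coeff_map_mem F _ i

/-- Laurent series whose coefficients lie in a finite subextension. -/
def Wfin (E U : Type) [Field E] [Field U] [Algebra E U] : Subfield (LaurentSeries U) where
  carrier := {f | ∃ F : IntermediateField E U, FiniteDimensional E F ∧ ∀ i, f.coeff i ∈ F}
  mul_mem' := by
    rintro f g ⟨F, hF, hf⟩ ⟨G, hG, hg⟩
    exact ⟨F ⊔ G, IntermediateField.finiteDimensional_sup F G, mul_coeff_mem _ f g
      (fun i => (le_sup_left : F ≤ F ⊔ G) (hf i)) (fun i => (le_sup_right : G ≤ F ⊔ G) (hg i))⟩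
  add_mem' := by
    rintro f g ⟨F, hF, hf⟩ ⟨G, hG, hg⟩
    exact ⟨F ⊔ G, IntermediateField.finiteDimensional_sup F G, fun i => add_mem
      ((le_sup_left : F ≤ F ⊔ G) (hf i)) ((le_sup_right : G ≤ F ⊔ G) (hg i))⟩
  one_mem' := ⟨⊥, inferInstance, fun i => by
    rw [HahnSeries.coeff_one]; split_ifs
    · exact one_mem _
    · exact zero_mem _⟩
  zero_mem' := ⟨⊥, inferInstance, fun i => zero_mem _⟩
  neg_mem' := by
    rintro f ⟨F, hF, hf⟩
    exact ⟨F, hF, fun i => neg_mem (hf i)⟩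
  inv_mem' := by
    rintro f ⟨F, hF, hf⟩
    exact ⟨F, hF, inv_coeff_mem F f hf⟩

theorem decomp (F : IntermediateField E U) [FiniteDimensional E F] (f : LaurentSeries U)
    (hf : ∀ i, f.coeff i ∈ F) :
    ∃ (n : ℕ) (u : Fin n → U) (g : Fin n → LaurentSeries U),
      f = ∑ k, HahnSeries.C (u k) * g k ∧
      (∀ k i, (g k).coeff i ∈ (algebraMap E U).range) ∧
      ∀ k i, f.coeff i = 0 → (g k).coeff i = 0 := by
  let b := Module.finBasis E F
  have h0 : ∀ k i, f.coeff i = 0 → algebraMap E U (b.repr ⟨f.coeff i, hf i⟩ k) = 0 := by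
    intro k i h
    have : (⟨f.coeff i, hf i⟩ : F) = 0 := Subtype.ext h
    rw [this]; simp
  refine ⟨_, fun k => (b k : U), fun k =>
    ⟨fun i => algebraMap E U (b.repr ⟨f.coeff i, hf i⟩ k), ?_⟩, ?_, ?_, h0⟩
  · refine f.isPWO_support.mono fun i hi => ?_
    intro h
    exact hi (h0 k i h)
  · ext i
    rw [HahnSeries.coeff_sum]
    simp only [HahnSeries.C_mul_eq_smul, HahnSeries.coeff_smul]
    have := congrArg (Subtype.val) (b.sum_repr ⟨f.coeff i, hf i⟩)
    refine this.symm.trans ?_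
    simp only [IntermediateField.coe_sum, IntermediateField.coe_smul, Algebra.smul_def, smul_eq_mul]
    exact Finset.sum_congr rfl fun k _ => mul_comm _ _
  · intro k i; exact ⟨_, rfl⟩

theorem mem_W [Algebra.IsAlgebraic E U] (f : LaurentSeries U) :
    f ∈ laurentCompositum E U ↔
      ∃ F : IntermediateField E U, FiniteDimensional E F ∧ ∀ i, f.coeff i ∈ F := by
  constructor
  · intro h
    have : laurentCompositum E U ≤ Wfin E U := by
      refine Subfield.closure_le.2 ?_
      rintro g (⟨u, rfl⟩ | hg)
      · refine ⟨IntermediateField.adjoin E {u}, IntermediateField.adjoin.finiteDimensional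
          (Algebra.IsIntegral.isIntegral u), fun i => ?_⟩
        rw [HahnSeries.C_apply, HahnSeries.coeff_single]
        split_ifs
        · exact IntermediateField.mem_adjoin_simple_self E u
        · exact zero_mem _
      · refine ⟨⊥, inferInstance, fun i => ?_⟩
        obtain ⟨e, he⟩ := hg i
        rw [← he]
        exact IntermediateField.algebraMap_mem _ e
    exact this h
  · rintro ⟨F, hF, hf⟩
    obtain ⟨n, u, g, h, hg, -⟩ := decomp F f hf
    rw [h]
    exact sum_mem fun k _ => mul_mem (Subfield.subset_closure (Or.inl ⟨_, rfl⟩))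
      (Subfield.subset_closure (Or.inr (hg k)))

theorem single_mem (n : ℤ) (e : E) :
    HahnSeries.single n (algebraMap E U e) ∈ laurentCompositum E U := by
  refine Subfield.subset_closure (Or.inr fun i => ?_)
  rw [HahnSeries.coeff_single]
  split_ifs
  · exact ⟨e, rfl⟩
  · exact zero_mem _

theorem v_le_one (f : LaurentSeries U) :
    Valued.v f ≤ (1 : WithZero (Multiplicative ℤ)) ↔ ∀ i : ℤ, i < 0 → f.coeff i = 0 := by
  have := LaurentSeries.valuation_le_iff_coeff_lt_eq_zero U (D := 0) (f := f)
  simpa using this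

theorem v_lt_one (f : LaurentSeries U) :
    Valued.v f < (1 : WithZero (Multiplicative ℤ)) ↔ ∀ i : ℤ, i < 1 → f.coeff i = 0 := by
  rw [← LaurentSeries.valuation_le_iff_coeff_lt_eq_zero U (D := 1) (f := f)]
  generalize (Valued.v f : WithZero (Multiplicative ℤ)) = x
  by_cases hx : x = 0
  · subst hx; simp
  · rw [← WithZero.exp_log hx, ← WithZero.exp_zero, WithZero.exp_lt_exp, WithZero.exp_le_exp]
    omega

end mem

section basisW
variable (q : ℕ) [Fact q.Prime] {E U : Type} [Field E] [Field U]
    [Algebra E U] [CharP E q] [CharP U q] [Algebra.IsSeparable E U] {ι : Type} [Fintype ι]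

/-- The candidate basis `b i * Z ^ j` of `W` over `W ^ q`. -/
noncomputable def bW (U : Type) [Field U] [Algebra E U] (b : ι → E) (p : Fin q × ι) :
    laurentCompositum E U :=
  ⟨HahnSeries.single ((p.1 : ℕ) : ℤ) (algebraMap E U (b p.2)), single_mem _ _⟩

theorem coeff_term (g : LaurentSeries U) (j j0 : Fin q) (m : ℤ) (u : U) :
    (g ^ q * HahnSeries.single ((j : ℕ) : ℤ) u).coeff (q * m + (j0 : ℕ)) =
      if j = j0 then g.coeff m ^ q * u else 0 := by
  have hq : q ≠ 0 := (Fact.out : q.Prime).ne_zero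
  have hq' : (q : ℤ) ≠ 0 := by exact_mod_cast hq
  rw [mul_comm, HahnSeries.coeff_single_mul, coeff_pow]
  by_cases h : j = j0
  · subst h
    rw [if_pos rfl, if_pos (by simp)]
    rw [add_sub_cancel_right, Int.mul_ediv_cancel_left _ hq', mul_comm]
  · rw [if_neg h, if_neg, mul_zero]
    intro hd
    apply h
    have h1 : (q : ℤ) ∣ ((j0 : ℕ) : ℤ) - ((j : ℕ) : ℤ) := by
      have := dvd_sub hd (Dvd.intro m rfl : (q : ℤ) ∣ q * m)
      have h3 : (q : ℤ) * m + ((j0 : ℕ) : ℤ) - ((j : ℕ) : ℤ) - q * m = ((j0 : ℕ) : ℤ) - ((j : ℕ) : ℤ) := by ring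
      rwa [h3] at this
    have hj := j.2
    have hj0 := j0.2
    have h2 := Int.eq_zero_of_abs_lt_dvd h1 (by rw [abs_lt]; constructor <;> omega)
    apply Fin.ext
    omega

theorem coeff_total (b : ι → E) (g : Fin q × ι → LaurentSeries U) (j0 : Fin q) (m : ℤ) :
    (∑ p, g p ^ q * HahnSeries.single ((p.1 : ℕ) : ℤ) (algebraMap E U (b p.2))).coeff
      (q * m + (j0 : ℕ)) = ∑ i, (g (j0, i)).coeff m ^ q * algebraMap E U (b i) := by
  rw [HahnSeries.coeff_sum, Fintype.sum_prod_type]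
  simp only [coeff_term]
  rw [Finset.sum_eq_single j0]
  · simp
  · intro j _ hj; simp [hj]
  · simp

theorem isPB_W (b : ι → E) (hb : IsPB q b) : IsPB q (bW q U b) := by
  have hqp : q.Prime := Fact.out
  have hq : q ≠ 0 := hqp.ne_zero
  have hq1 : (1 : ℤ) ≤ q := by exact_mod_cast hqp.one_lt.le
  have hq0 : (0 : ℤ) < q := by omega
  have hco : ∀ c : Fin q × ι → laurentCompositum E U,
      ((∑ p, c p ^ q * bW q U b p : laurentCompositum E U) : LaurentSeries U) =
      ∑ p, (c p : LaurentSeries U) ^ q *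
        HahnSeries.single ((p.1 : ℕ) : ℤ) (algebraMap E U (b p.2)) := by
    intro c
    rw [AddSubmonoidClass.coe_finsetSum]
    rfl
  constructor
  · rintro ⟨f, hf⟩
    obtain ⟨F, hF, hfF⟩ := (mem_W f).1 hf
    choose d hdF hd using fun n => span_ext q b hb F (f.coeff n) (hfF n)
    have hd0 : ∀ n, f.coeff n = 0 → ∀ i, d n i = 0 := fun n hn i =>
      li_ext q b hb (d n) (by rw [← hd, hn]) i
    obtain ⟨N, hN⟩ : ∃ N : ℤ, ∀ n < N, f.coeff n = 0 :=
      ⟨f.order, fun n hn => HahnSeries.coeff_eq_zero_of_lt_order hn⟩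
    let g : Fin q × ι → LaurentSeries U := fun p =>
      HahnSeries.ofSuppBddBelow (fun m : ℤ => d (q * m + (p.1 : ℕ)) p.2) (by
        refine ⟨min N 0 - 1, fun m hm => ?_⟩
        by_contra hlt
        push Not at hlt
        apply hm
        apply hd0
        apply hN
        have h1 := p.1.2
        have h2 : m + 1 < N := by omega
        have h3 : m + 1 < 0 := by omega
        have h4 : (q : ℤ) * (m + 1) ≤ m + 1 := by nlinarith
        have h5 : (((p.1 : ℕ) : ℤ)) < q := by exact_mod_cast h1
        linarith)
    have hgW : ∀ p, g p ∈ laurentCompositum E U := fun p =>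
      (mem_W _).2 ⟨F, hF, fun i => hdF _ _⟩
    refine ⟨fun p => ⟨g p, hgW p⟩, ?_⟩
    apply Subtype.ext
    rw [hco]
    ext n
    have hr0 := Int.emod_nonneg n hq0.ne'
    have hr1 := Int.emod_lt_of_pos n hq0
    have hn : n = q * (n / q) + (((⟨(n % q).toNat, by omega⟩ : Fin q) : ℕ) : ℤ) := by
      simp only [Int.toNat_of_nonneg hr0]
      exact (Int.mul_ediv_add_emod n q).symm
    generalize (⟨(n % q).toNat, by omega⟩ : Fin q) = j0 at hn
    generalize n / q = m at hn
    subst hn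
    rw [coeff_total q b g]
    exact hd _
  · intro c hc p
    have h1 := hco c
    rw [hc] at h1
    apply Subtype.ext
    ext m
    have h2 := coeff_total q b (fun p => (c p : LaurentSeries U)) p.1 m
    rw [← h1] at h2
    exact li_ext q b hb (fun i => (c (p.1, i) : LaurentSeries U).coeff m) h2.symm p.2

end basisW

end LCV

/-- with `W = U ⬝ E((Z)) ⊆ U((Z))` and `w` the restriction of the `Z`-adic
valuation: `w(W^×) = ℤ`, the valuation ring is `U ⬝ E[[Z]]`, the residue field of `(W, w)`
is `U`, and `[W : W^q] = q^(1+δ)` if `[E : E^q] = q^δ`. -/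
theorem laurent_compositum_valuation (q : ℕ) [Fact q.Prime] (E U : Type) [Field E] [Field U]
    [Algebra E U] [CharP E q] [CharP U q] [Algebra.IsSeparable E U] (δ : ℕ)
    (hE : Module.finrank ((frobenius E q).fieldRange) E = q ^ δ) :
    let W := laurentCompositum E U
    let OW : Subring (LaurentSeries U) :=
      W.toSubring ⊓
        (Valued.v (R := LaurentSeries U)
          (Γ₀ := WithZero (Multiplicative ℤ))).valuationSubring.toSubring
    -- the value group of `w` on `W` is all of `ℤ`
    (∀ γ : WithZero (Multiplicative ℤ), γ ≠ 0 → ∃ f ∈ W, f ≠ 0 ∧ Valued.v f = γ) ∧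
    -- the valuation ring of `(W, w)` is `U ⬝ E[[Z]]`
    ((OW : Set (LaurentSeries U)) =
      (Subring.closure
        (Set.range (HahnSeries.C : U →+* LaurentSeries U) ∪
          {f : LaurentSeries U | (∀ i : ℤ, f.coeff i ∈ (algebraMap E U).range) ∧
            ∀ i : ℤ, i < 0 → f.coeff i = 0}) : Set (LaurentSeries U))) ∧
    -- the residue field of `(W, w)` is `U`
    (∃ φ : ↥OW →+* U, Function.Surjective φ ∧
      ∀ f : ↥OW, φ f = 0 ↔
        Valued.v ((f : LaurentSeries U)) < (1 : WithZero (Multiplicative ℤ))) ∧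
    -- `[W : W^q] = q^(1+δ)`
    Module.finrank ((frobenius ↥(laurentCompositum E U) q).fieldRange)
      ↥(laurentCompositum E U) = q ^ (1 + δ) := by
  intro W OW
  have hOW : ∀ f, f ∈ OW ↔ f ∈ laurentCompositum E U ∧ ∀ i : ℤ, i < 0 → f.coeff i = 0 := by
    intro f
    rw [← LCV.v_le_one]
    rfl
  refine ⟨?_, ?_, ?_, ?_⟩
  · intro γ hγ
    refine ⟨HahnSeries.single (-WithZero.log γ) (1 : U), ?_, ?_, ?_⟩
    · have := LCV.single_mem (U := U) (-WithZero.log γ) (1 : E)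
      rwa [map_one] at this
    · simp
    · rw [LaurentSeries.valuation_single_zpow, neg_neg, WithZero.exp_log hγ]
  · apply Set.Subset.antisymm
    · intro f hf
      obtain ⟨hfW, hf0⟩ := (hOW f).1 hf
      obtain ⟨F, hF, hfF⟩ := (LCV.mem_W f).1 hfW
      obtain ⟨n, u, g, h, hg, hg0⟩ := LCV.decomp F f hfF
      rw [h]
      exact sum_mem fun k _ => mul_mem (Subring.subset_closure (Or.inl ⟨_, rfl⟩))
        (Subring.subset_closure (Or.inr ⟨hg k, fun i hi => hg0 k i (hf0 i hi)⟩))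
    · refine (Subring.closure_le (t := OW)).2 ?_
      rintro f (⟨u, rfl⟩ | ⟨h1, h2⟩)
      · refine (hOW _).2 ⟨Subfield.subset_closure (Or.inl ⟨_, rfl⟩), fun i hi => ?_⟩
        rw [HahnSeries.C_apply, HahnSeries.coeff_single_of_ne hi.ne]
      · exact (hOW _).2 ⟨Subfield.subset_closure (Or.inr h1), h2⟩
  · have hps : ∀ f : OW, ∃ P : PowerSeries U, HahnSeries.ofPowerSeries ℤ U P = f := fun f =>
      (LaurentSeries.val_le_one_iff_eq_coe U _).1 ((LCV.v_le_one _).2 ((hOW f).1 f.2).2)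
    have hc0 : ∀ P : PowerSeries U, (HahnSeries.ofPowerSeries ℤ U P).coeff 0 =
        PowerSeries.constantCoeff P := fun P => by
      rw [PowerSeries.coeff_coe]; simp
    refine ⟨{ toFun := fun f => (f : LaurentSeries U).coeff 0
              map_one' := by simp
              map_zero' := by simp
              map_add' := fun f g => by simp
              map_mul' := fun f g => ?_ }, fun u => ?_, fun f => ?_⟩
    · obtain ⟨P, hP⟩ := hps f
      obtain ⟨Q, hQ⟩ := hps g
      have : ((f * g : OW) : LaurentSeries U) = HahnSeries.ofPowerSeries ℤ U (P * Q) := by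
        rw [map_mul, hP, hQ]; rfl
      rw [this, ← hP, ← hQ, hc0, hc0, hc0, map_mul]
    · refine ⟨⟨HahnSeries.C u, (hOW _).2 ⟨Subfield.subset_closure (Or.inl ⟨_, rfl⟩),
        fun i hi => ?_⟩⟩, ?_⟩
      · rw [HahnSeries.C_apply, HahnSeries.coeff_single_of_ne hi.ne]
      · simp
    · rw [LCV.v_lt_one]
      constructor
      · intro h i hi
        rcases lt_or_eq_of_le (Int.lt_add_one_iff.1 (by simpa using hi) : i ≤ 0) with h1 | h1
        · exact ((hOW f).1 f.2).2 i h1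
        · rw [h1]; exact h
      · intro h; exact h 0 one_pos
  · have hq : q.Prime := Fact.out
    obtain ⟨b, hb⟩ := LCV.exists_isPB q (K := E) (q ^ δ) (pow_pos hq.pos δ) hE
    rw [LCV.finrank_of_isPB q _ (LCV.isPB_W q (U := U) b hb)]
    simp [pow_add]
end
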